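/- arXiv:1906.05931 — 2 statements merged into one kernel-verified Lean document; each statement's English description precedes it below -/
import Mathlib

section
/- Let a, b, p, q be real numbers and set E = b^2 - abp + a^2·q. For every natural number n ≥ 2, the Gelin-Cesàro identity holds: h_{n-2}·h_{n-1}·h_{n+1}·h_{n+2} - h_n^4 = E·(p^2 - 4q)·q^{n-2}·[(p^2 + q)·h_n^2 + E·(p^2 - 4q)·p^2·q^{n-1}]. -/
/-- Second-order linear recurrence sequence with coefficients `p, q`
and initial values `x0, x1`: `x (n+2) = p * x (n+1) - q * x n`. -/
def rec2 (p q x0 x1 : ℝ) : ℕ → ℝ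
  | 0 => x0
  | 1 => x1
  | n + 2 => p * rec2 p q x0 x1 (n + 1) - q * rec2 p q x0 x1 n

/-- The Horadam sequence `w_0 = a`, `w_1 = b`. -/
noncomputable def horadam (a b p q : ℝ) : ℕ → ℝ := rec2 p q a b

/-- The Horadam-Lucas sequence `h_0 = 2b - ap`, `h_1 = bp - 2aq`. -/
noncomputable def horadamLucas (a b p q : ℝ) : ℕ → ℝ :=
  rec2 p q (2 * b - a * p) (b * p - 2 * a * q)

/-- The sequence `u` with `u_0 = 0`, `u_1 = 1`. -/
noncomputable def useq (p q : ℝ) : ℕ → ℝ := rec2 p q 0 1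

/-- The sequence `v` with `v_0 = 2`, `v_1 = p`. -/
noncomputable def vseq (p q : ℝ) : ℕ → ℝ := rec2 p q 2 p

theorem rec2_add_two (p q x0 x1 : ℝ) (n : ℕ) :
    rec2 p q x0 x1 (n + 2) = p * rec2 p q x0 x1 (n + 1) - q * rec2 p q x0 x1 n := rfl

/-- Cassini's identity for second-order linear recurrences. -/
theorem rec2_cassini (p q x0 x1 : ℝ) (n : ℕ) :
    rec2 p q x0 x1 n * rec2 p q x0 x1 (n + 2) - rec2 p q x0 x1 (n + 1) ^ 2 =
      (p * x0 * x1 - q * x0 ^ 2 - x1 ^ 2) * q ^ n := by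
  induction n with
  | zero => simp only [rec2]; ring
  | succ n ih =>
    rw [pow_succ q, ← mul_assoc, ← ih, rec2_add_two p q x0 x1 (n + 1), rec2_add_two]
    ring

/-- Catalan's identity with step two for second-order linear recurrences. -/
theorem rec2_catalan_two (p q x0 x1 : ℝ) (n : ℕ) :
    rec2 p q x0 x1 n * rec2 p q x0 x1 (n + 4) - rec2 p q x0 x1 (n + 2) ^ 2 =
      p ^ 2 * ((p * x0 * x1 - q * x0 ^ 2 - x1 ^ 2) * q ^ n) := by
  rw [← rec2_cassini, rec2_add_two p q x0 x1 (n + 2), rec2_add_two p q x0 x1 (n + 1),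
    rec2_add_two]
  ring

theorem gelin_cesaro_horadamLucas (a b p q : ℝ) (E : ℝ)
    (hE : E = b ^ 2 - a * b * p + a ^ 2 * q) (n : ℕ) (hn : 2 ≤ n) :
    horadamLucas a b p q (n - 2) * horadamLucas a b p q (n - 1) *
        horadamLucas a b p q (n + 1) * horadamLucas a b p q (n + 2) -
        horadamLucas a b p q n ^ 4 =
      E * (p ^ 2 - 4 * q) * q ^ (n - 2) *
        ((p ^ 2 + q) * horadamLucas a b p q n ^ 2 +
          E * (p ^ 2 - 4 * q) * p ^ 2 * q ^ (n - 1)) := by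
  obtain ⟨m, rfl⟩ := Nat.exists_eq_add_of_le' hn
  have hdisc : p * (2 * b - a * p) * (b * p - 2 * a * q) - q * (2 * b - a * p) ^ 2 -
      (b * p - 2 * a * q) ^ 2 = E * (p ^ 2 - 4 * q) := by
    rw [hE]; ring
  have hcassini : horadamLucas a b p q (m + 1) * horadamLucas a b p q (m + 3) =
      horadamLucas a b p q (m + 2) ^ 2 + E * (p ^ 2 - 4 * q) * q ^ (m + 1) := by
    rw [← hdisc, ← sub_eq_iff_eq_add']
    exact rec2_cassini p q _ _ (m + 1)
  have hcatalan : horadamLucas a b p q m * horadamLucas a b p q (m + 4) =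
      horadamLucas a b p q (m + 2) ^ 2 + p ^ 2 * (E * (p ^ 2 - 4 * q) * q ^ m) := by
    rw [← hdisc, ← sub_eq_iff_eq_add']
    exact rec2_catalan_two p q _ _ m
  change horadamLucas a b p q m * horadamLucas a b p q (m + 1) *
      horadamLucas a b p q (m + 3) * horadamLucas a b p q (m + 4) -
      horadamLucas a b p q (m + 2) ^ 4 =
    E * (p ^ 2 - 4 * q) * q ^ m * ((p ^ 2 + q) * horadamLucas a b p q (m + 2) ^ 2 +
      E * (p ^ 2 - 4 * q) * p ^ 2 * q ^ (m + 1))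
  rw [mul_assoc (horadamLucas a b p q m), hcassini, mul_right_comm, hcatalan]
  ring
end

section
/- Let a, b, p, q be real numbers. For all natural numbers n and k with n ≥ k, the Melham identity holds: h_{n+k+1}^2 - q^{2k+1}·h_{n-k}^2 = (p^2 - 4q)·u_{2k+1}·[(b^2 - a^2·q)·u_{2n+1} - a·q·(2b - ap)·u_{2n}]. -/
theorem useq_add_two (p q : ℝ) (n : ℕ) :
    useq p q (n + 2) = p * useq p q (n + 1) - q * useq p q n :=
  rec2_add_two p q 0 1 n

theorem rec2_add (p q x0 x1 : ℝ) (m j : ℕ) :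
    rec2 p q x0 x1 (m + j) = useq p q j * rec2 p q x0 x1 (m + 1) +
      (useq p q (j + 1) - p * useq p q j) * rec2 p q x0 x1 m := by
  induction j using Nat.twoStepInduction with
  | zero => simp [useq, rec2]
  | one => simp [useq, rec2]
  | more j ih₀ ih₁ =>
    rw [← add_assoc, rec2_add_two, add_assoc m j 1, ih₀, ih₁, useq_add_two p q (j + 1),
      useq_add_two p q j]
    ring

theorem useq_norm (p q : ℝ) (n : ℕ) :
    useq p q (n + 1) ^ 2 - p * useq p q (n + 1) * useq p q n + q * useq p q n ^ 2 = q ^ n := by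
  induction n with
  | zero => simp [useq, rec2]
  | succ n ih =>
    rw [useq_add_two, pow_succ q n, ← ih]
    ring

theorem horadamLucas_sq_sub (a b p q : ℝ) (m : ℕ) :
    horadamLucas a b p q (m + 1) ^ 2 - q * horadamLucas a b p q m ^ 2 =
        (p ^ 2 - 4 * q) * ((b ^ 2 - a ^ 2 * q) * useq p q (2 * m + 1) -
          a * q * (2 * b - a * p) * useq p q (2 * m)) ∧
      p * horadamLucas a b p q (m + 1) ^ 2 -
          2 * q * horadamLucas a b p q m * horadamLucas a b p q (m + 1) =
        (p ^ 2 - 4 * q) * ((b ^ 2 - a ^ 2 * q) * useq p q (2 * m + 2) -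
          a * q * (2 * b - a * p) * useq p q (2 * m + 1)) := by
  induction m with
  | zero =>
    simp only [horadamLucas, useq, rec2]
    constructor <;> ring
  | succ m ih =>
    obtain ⟨h₀, h₁⟩ := ih
    have hh : horadamLucas a b p q (m + 1 + 1) =
        p * horadamLucas a b p q (m + 1) - q * horadamLucas a b p q m :=
      rec2_add_two ..
    rw [hh, show 2 * (m + 1) = 2 * m + 2 by ring, useq_add_two p q (2 * m + 2),
      show 2 * m + 2 + 1 = 2 * m + 1 + 2 by ring, useq_add_two p q (2 * m + 1)]
    rw [useq_add_two p q (2 * m)] at h₁ ⊢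
    constructor
    · linear_combination p * h₁ - q * h₀
    · linear_combination (p ^ 2 - q) * h₁ - p * q * h₀

theorem melham_horadamLucas (a b p q : ℝ) (n k : ℕ) (hkn : k ≤ n) :
    horadamLucas a b p q (n + k + 1) ^ 2 -
        q ^ (2 * k + 1) * horadamLucas a b p q (n - k) ^ 2 =
      (p ^ 2 - 4 * q) * useq p q (2 * k + 1) *
        ((b ^ 2 - a ^ 2 * q) * useq p q (2 * n + 1) -
          a * q * (2 * b - a * p) * useq p q (2 * n)) := by
  obtain ⟨m, rfl⟩ := Nat.exists_eq_add_of_le' hkn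
  obtain ⟨h₀, h₁⟩ := horadamLucas_sq_sub a b p q m
  have hh : horadamLucas a b p q (m + (2 * k + 1)) =
      useq p q (2 * k + 1) * horadamLucas a b p q (m + 1) +
        (useq p q (2 * k + 1 + 1) - p * useq p q (2 * k + 1)) * horadamLucas a b p q m :=
    rec2_add ..
  have hu₀ : useq p q (2 * m + 2 * k) = useq p q (2 * k) * useq p q (2 * m + 1) +
      (useq p q (2 * k + 1) - p * useq p q (2 * k)) * useq p q (2 * m) :=
    rec2_add ..
  have hu₁ : useq p q (2 * m + 1 + 2 * k) = useq p q (2 * k) * useq p q (2 * m + 1 + 1) +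
      (useq p q (2 * k + 1) - p * useq p q (2 * k)) * useq p q (2 * m + 1) :=
    rec2_add ..
  rw [show m + k + k + 1 = m + (2 * k + 1) by ring, Nat.add_sub_cancel, hh,
    show 2 * (m + k) + 1 = 2 * m + 1 + 2 * k by ring, mul_add 2 m k, hu₀, hu₁,
    useq_add_two p q (2 * k), pow_succ q (2 * k), ← useq_norm p q (2 * k)]
  linear_combination useq p q (2 * k + 1) *
    (useq p q (2 * k) * h₁ + (useq p q (2 * k + 1) - p * useq p q (2 * k)) * h₀)
end
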